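/- Let ρ : [0,1]×[0,T] → ℝ be strictly positive, of class C¹ in t and C² in x, with ρ_tx continuous, and suppose ρ_x(0,t) = ρ_x(1,t) = 0 for all t ∈ [0,T]. Then for every t ∈ [0,T]: − ∫₀¹ ρ_t(x,t) · ((√ρ)_xx/√ρ)(x,t) dx = (d/dt) ∫₀¹ ((√ρ)_x(x,t))² dx. -/

import Mathlib

open MeasureTheory Real Set

/-- Partial derivative in the first (space) variable. -/
noncomputable def pdx (f : ℝ → ℝ → ℝ) (x t : ℝ) : ℝ := deriv (fun y => f y t) x

/-- Partial derivative in the second (time) variable. -/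
noncomputable def pdt (f : ℝ → ℝ → ℝ) (x t : ℝ) : ℝ := deriv (fun s => f x s) t

/-- Pointwise square root of a function of `(x, t)`. -/
noncomputable def sqf (ρ : ℝ → ℝ → ℝ) (x t : ℝ) : ℝ := Real.sqrt (ρ x t)

open Filter Topology

/-- A derivative formula for the Dirichlet energy `∫ (∂ₓr)²` under Neumann boundary conditions.
It requires no mixed derivative of `r`: integrating by parts in the difference of the energies at
two times moves all space derivatives onto one factor. -/
theorem hasDerivWithinAt_integral_sq_of_neumann {T : ℝ} {r v w q : ℝ → ℝ → ℝ}
    (hr : ∀ x ∈ Icc (0:ℝ) 1, ∀ t ∈ Icc (0:ℝ) T, HasDerivAt (fun y => r y t) (v x t) x)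
    (hv : ∀ x ∈ Icc (0:ℝ) 1, ∀ t ∈ Icc (0:ℝ) T, HasDerivAt (fun y => v y t) (w x t) x)
    (hq : ∀ x ∈ Icc (0:ℝ) 1, ∀ t ∈ Icc (0:ℝ) T,
      HasDerivWithinAt (fun s => r x s) (q x t) (Icc 0 T) t)
    (hwc : ContinuousOn (fun p : ℝ × ℝ => w p.1 p.2) (Icc 0 1 ×ˢ Icc 0 T))
    (hqc : ContinuousOn (fun p : ℝ × ℝ => q p.1 p.2) (Icc 0 1 ×ˢ Icc 0 T))
    (hbd : ∀ t ∈ Icc (0:ℝ) T, v 0 t = 0 ∧ v 1 t = 0) {t : ℝ} (ht : t ∈ Icc (0:ℝ) T) :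
    HasDerivWithinAt (fun s => ∫ x in (0:ℝ)..1, v x s ^ 2)
      (- ∫ x in (0:ℝ)..1, q x t * (w x t + w x t)) (Icc 0 T) t := by
  have huI : uIcc (0:ℝ) 1 = Icc 0 1 := uIcc_of_le zero_le_one
  have hK : IsCompact (Icc (0:ℝ) 1 ×ˢ Icc (0:ℝ) T) := isCompact_Icc.prod isCompact_Icc
  obtain ⟨M, hM⟩ := hK.exists_bound_of_continuousOn hwc
  obtain ⟨C, hC⟩ := hK.exists_bound_of_continuousOn hqc
  have hrc : ∀ s ∈ Icc (0:ℝ) T, ContinuousOn (fun x => r x s) (Icc 0 1) := fun s hs x hx =>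
    (hr x hx s hs).continuousAt.continuousWithinAt
  have hvc : ∀ s ∈ Icc (0:ℝ) T, ContinuousOn (fun x => v x s) (Icc 0 1) := fun s hs x hx =>
    (hv x hx s hs).continuousAt.continuousWithinAt
  have hwx : ∀ s ∈ Icc (0:ℝ) T, ContinuousOn (fun x => w x s) (Icc 0 1) := fun s hs =>
    hwc.comp (f := fun x : ℝ => (x, s)) (by fun_prop) (fun x hx => ⟨hx, hs⟩)
  have hwt : ∀ x ∈ Icc (0:ℝ) 1, ContinuousOn (fun s => w x s) (Icc 0 T) := fun x hx =>
    hwc.comp (f := fun s : ℝ => (x, s)) (by fun_prop) (fun s hs => ⟨hx, hs⟩)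
  have hint : ∀ {f : ℝ → ℝ}, ContinuousOn f (Icc 0 1) → IntervalIntegrable f volume 0 1 :=
    fun hf => ContinuousOn.intervalIntegrable (by rwa [huI])
  have energy_diff : ∀ s ∈ Icc (0:ℝ) T, (∫ x in (0:ℝ)..1, v x s ^ 2) - ∫ x in (0:ℝ)..1, v x t ^ 2
      = - ∫ x in (0:ℝ)..1, (w x s + w x t) * (r x s - r x t) := by
    intro s hs
    have key := intervalIntegral.integral_mul_deriv_eq_deriv_mul (a := (0:ℝ)) (b := 1)
      (u := fun x => v x s + v x t) (u' := fun x => w x s + w x t)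
      (v := fun x => r x s - r x t) (v' := fun x => v x s - v x t)
      (fun x hx => (hv x (huI ▸ hx) s hs).add (hv x (huI ▸ hx) t ht))
      (fun x hx => (hr x (huI ▸ hx) s hs).sub (hr x (huI ▸ hx) t ht))
      (hint ((hwx s hs).add (hwx t ht))) (hint ((hvc s hs).sub (hvc t ht)))
    simp only [hbd s hs, hbd t ht, add_zero, zero_mul, sub_zero, zero_sub] at key
    have hsq : ∀ τ ∈ Icc (0:ℝ) T, IntervalIntegrable (fun x => v x τ ^ 2) volume 0 1 :=
      fun τ hτ => hint ((hvc τ hτ).pow 2)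
    rw [← intervalIntegral.integral_sub (hsq s hs) (hsq t ht), ← key]
    exact intervalIntegral.integral_congr fun x _ => by ring
  rw [hasDerivWithinAt_iff_tendsto_slope]
  have hmem : ∀ᶠ s in 𝓝[Icc 0 T \ {t}] t, s ∈ Icc (0:ℝ) T \ {t} := eventually_mem_nhdsWithin
  have hlim : Tendsto
      (fun s => ∫ x in (0:ℝ)..1, slope (fun s => r x s) t s * (w x s + w x t))
      (𝓝[Icc 0 T \ {t}] t) (𝓝 (∫ x in (0:ℝ)..1, q x t * (w x t + w x t))) := by
    apply intervalIntegral.tendsto_integral_filter_of_dominated_convergence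
      (fun _ => C * (M + M))
    · filter_upwards [hmem] with s hs
      refine (hint ?_).def'.aestronglyMeasurable
      simp only [slope_def_field]
      exact (((hrc s hs.1).sub (hrc t ht)).div_const _).mul ((hwx s hs.1).add (hwx t ht))
    · filter_upwards [hmem] with s hs
      refine Eventually.of_forall fun x hx => ?_
      have hx' : x ∈ Icc (0:ℝ) 1 := huI ▸ uIoc_subset_uIcc hx
      have hst : 0 < ‖s - t‖ := norm_pos_iff.2 (sub_ne_zero.2 hs.2)
      have hslope : ‖slope (fun s => r x s) t s‖ ≤ C := by
        rw [slope_def_field, norm_div, div_le_iff₀ hst]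
        exact (convex_Icc (0:ℝ) T).norm_image_sub_le_of_norm_hasDerivWithin_le
          (fun τ hτ => hq x hx' τ hτ) (fun τ hτ => hC (x, τ) ⟨hx', hτ⟩) ht hs.1
      rw [norm_mul]
      exact mul_le_mul hslope
        (norm_add_le_of_le (hM (x, s) ⟨hx', hs.1⟩) (hM (x, t) ⟨hx', ht⟩))
        (norm_nonneg _) ((norm_nonneg _).trans hslope)
    · exact intervalIntegrable_const
    · refine Eventually.of_forall fun x hx => ?_
      have hx' : x ∈ Icc (0:ℝ) 1 := huI ▸ uIoc_subset_uIcc hx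
      exact (hasDerivWithinAt_iff_tendsto_slope.1 (hq x hx' t ht)).mul
        ((((hwt x hx') t ht).mono_left (nhdsWithin_mono _ sdiff_subset)).add_const _)
  refine hlim.neg.congr' ?_
  filter_upwards [hmem] with s hs
  rw [slope_def_field, energy_diff s hs.1, neg_div, ← intervalIntegral.integral_div]
  congr 1
  refine intervalIntegral.integral_congr fun x _ => ?_
  simp only [slope_def_field]
  ring

/-- For a positive density `ρ` on `[0,1] × [0,T]` (`C¹` in `t`, `C²` in `x`, with `ρ_tx`
continuous) satisfying Neumann boundary conditions `ρ_x(0,t) = ρ_x(1,t) = 0`, the Bohm term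
produces the time derivative of the quantum energy:
`−∫₀¹ ρ_t · (√ρ)_xx/√ρ dx = (d/dt) ∫₀¹ ((√ρ)_x)² dx`. -/
theorem bohm_quantum_energy_derivative
    (T : ℝ) (hT : 0 ≤ T) (ρ : ℝ → ℝ → ℝ)
    (hpos : ∀ x ∈ Set.Icc (0:ℝ) 1, ∀ t ∈ Set.Icc (0:ℝ) T, 0 < ρ x t)
    (hρ_C1_t : ∀ x ∈ Set.Icc (0:ℝ) 1, ContDiff ℝ 1 (fun t => ρ x t))
    (hρ_C2_x : ∀ t ∈ Set.Icc (0:ℝ) T, ContDiff ℝ 2 (fun x => ρ x t))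
    (hρ_cont : Continuous fun p : ℝ × ℝ => ρ p.1 p.2)
    (hρt_cont : Continuous fun p : ℝ × ℝ => pdt ρ p.1 p.2)
    (hρx_cont : Continuous fun p : ℝ × ℝ => pdx ρ p.1 p.2)
    (hρxx_cont : Continuous fun p : ℝ × ℝ => pdx (pdx ρ) p.1 p.2)
    (hρtx_cont : Continuous fun p : ℝ × ℝ => pdt (pdx ρ) p.1 p.2)
    (hNeumann : ∀ t ∈ Set.Icc (0:ℝ) T, pdx ρ 0 t = 0 ∧ pdx ρ 1 t = 0) :
    ∀ t ∈ Set.Icc (0:ℝ) T,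
      HasDerivWithinAt (fun s => ∫ x in (0:ℝ)..1, (pdx (sqf ρ) x s) ^ 2)
        (- ∫ x in (0:ℝ)..1, pdt ρ x t * (pdx (pdx (sqf ρ)) x t / sqf ρ x t))
        (Set.Icc 0 T) t := by
  intro t ht
  have hderiv_x : ∀ x, ∀ t ∈ Icc (0:ℝ) T, HasDerivAt (fun y => ρ y t) (pdx ρ x t) x :=
    fun x t ht => ((hρ_C2_x t ht).differentiable (by norm_num) x).hasDerivAt
  have hderiv_xx : ∀ x, ∀ t ∈ Icc (0:ℝ) T,
      HasDerivAt (fun y => pdx ρ y t) (pdx (pdx ρ) x t) x := by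
    intro x t ht
    have h : ContDiff ℝ 1 (deriv fun y => ρ y t) :=
      ContDiff.deriv' (n := 1) (by simpa [one_add_one_eq_two] using hρ_C2_x t ht)
    exact (h.differentiable (by norm_num) x).hasDerivAt
  have hderiv_t : ∀ x ∈ Icc (0:ℝ) 1, ∀ t, HasDerivAt (fun s => ρ x s) (pdt ρ x t) t :=
    fun x hx t => ((hρ_C1_t x hx).differentiable (by norm_num) t).hasDerivAt
  have hsq_x : ∀ x, ∀ t ∈ Icc (0:ℝ) T, 0 < ρ x t →
      HasDerivAt (fun y => sqf ρ y t) (pdx ρ x t / (2 * sqf ρ x t)) x :=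
    fun x t ht hp => (hderiv_x x t ht).sqrt hp.ne'
  have hsqpos : ∀ x ∈ Icc (0:ℝ) 1, ∀ t ∈ Icc (0:ℝ) T, 0 < sqf ρ x t :=
    fun x hx t ht => Real.sqrt_pos.2 (hpos x hx t ht)
  have hpdx_sq : ∀ x ∈ Icc (0:ℝ) 1, ∀ t ∈ Icc (0:ℝ) T,
      (fun y => pdx (sqf ρ) y t) =ᶠ[𝓝 x] fun y => pdx ρ y t / (2 * sqf ρ y t) := by
    intro x hx t ht
    filter_upwards [(hderiv_x x t ht).continuousAt.eventually (lt_mem_nhds (hpos x hx t ht))]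
      with y hy
    exact (hsq_x y t ht hy).deriv
  have hsq_xx : ∀ x ∈ Icc (0:ℝ) 1, ∀ t ∈ Icc (0:ℝ) T,
      HasDerivAt (fun y => pdx (sqf ρ) y t)
        ((pdx (pdx ρ) x t * (2 * sqf ρ x t) - pdx ρ x t * (2 * (pdx ρ x t / (2 * sqf ρ x t))))
          / (2 * sqf ρ x t) ^ 2) x := fun x hx t ht =>
    ((hderiv_xx x t ht).div ((hsq_x x t ht (hpos x hx t ht)).const_mul 2)
      (mul_pos two_pos (hsqpos x hx t ht)).ne').congr_of_eventuallyEq (hpdx_sq x hx t ht)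
  have hsq_cont : Continuous fun p : ℝ × ℝ => sqf ρ p.1 p.2 := hρ_cont.sqrt
  have hne : ∀ p ∈ Icc (0:ℝ) 1 ×ˢ Icc (0:ℝ) T, 2 * sqf ρ p.1 p.2 ≠ 0 := fun p hp =>
    (mul_pos two_pos (hsqpos p.1 hp.1 p.2 hp.2)).ne'
  have hw_cont : ContinuousOn (fun p : ℝ × ℝ => pdx (pdx (sqf ρ)) p.1 p.2)
      (Icc 0 1 ×ˢ Icc 0 T) := by
    have hdiv : ContinuousOn (fun p : ℝ × ℝ => pdx ρ p.1 p.2 / (2 * sqf ρ p.1 p.2))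
        (Icc 0 1 ×ˢ Icc 0 T) :=
      hρx_cont.continuousOn.div (hsq_cont.const_mul 2).continuousOn hne
    refine ContinuousOn.congr (ContinuousOn.div
      (((hρxx_cont.mul (hsq_cont.const_mul 2)).continuousOn).sub
        (hρx_cont.continuousOn.mul (hdiv.const_mul 2)))
      ((hsq_cont.const_mul 2).pow 2).continuousOn fun p hp => pow_ne_zero 2 (hne p hp))
      fun p hp => (hsq_xx p.1 hp.1 p.2 hp.2).deriv
  have hE := hasDerivWithinAt_integral_sq_of_neumann (T := T) (r := sqf ρ) (v := pdx (sqf ρ))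
    (w := pdx (pdx (sqf ρ))) (q := fun x t => pdt ρ x t / (2 * sqf ρ x t))
    (fun x hx t ht => (hsq_x x t ht (hpos x hx t ht)).differentiableAt.hasDerivAt)
    (fun x hx t ht => (hsq_xx x hx t ht).differentiableAt.hasDerivAt)
    (fun x hx t ht => ((hderiv_t x hx t).sqrt (hpos x hx t ht).ne').hasDerivWithinAt)
    hw_cont (hρt_cont.continuousOn.div (hsq_cont.const_mul 2).continuousOn hne)
    (fun t ht => ⟨by rw [(hpdx_sq 0 (by simp) t ht).eq_of_nhds, (hNeumann t ht).1, zero_div],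
      by rw [(hpdx_sq 1 (by simp) t ht).eq_of_nhds, (hNeumann t ht).2, zero_div]⟩) ht
  convert hE using 2
  refine intervalIntegral.integral_congr fun x _ => ?_
  ring
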